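/- Let G be a graph with a stable set twin class X that sees some other twin class Y (every vertex of X is adjacent to every vertex of Y). Let S be a maximal stable set of G containing a vertex of Y. If |X| > k·|S|, then G is not k-equistable. -/

import Mathlib

open Finset

variable {V : Type*}

/-- Two vertices are twins if they have the same neighbors other than each other. -/
def Twins (G : SimpleGraph V) (u v : V) : Prop :=
  G.neighborSet u \ {v} = G.neighborSet v \ {u}

/-- A twin class is an equivalence class of the twin relation. -/
def TwinClass (G : SimpleGraph V) (C : Set V) : Prop :=
  ∃ u, C = {v | Twins G u v}

/-- A stable (independent) set of vertices. -/
def IsStable (G : SimpleGraph V) (S : Set V) : Prop :=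
  ∀ ⦃x⦄, x ∈ S → ∀ ⦃y⦄, y ∈ S → ¬ G.Adj x y

/-- A maximal stable set. -/
def IsMaxStable [Fintype V] [DecidableEq V] (G : SimpleGraph V) (S : Finset V) : Prop :=
  IsStable G ↑S ∧ ∀ T : Finset V, IsStable G ↑T → S ⊆ T → S = T

/-- `(w, t)` is an equistable structure of `G`: a set is a maximal stable set
iff its total weight is `t`. -/
def EquistableStruct [Fintype V] [DecidableEq V] (G : SimpleGraph V) (w : V → ℕ) (t : ℕ) : Prop :=
  ∀ S : Finset V, IsMaxStable G S ↔ ∑ x ∈ S, w x = t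

/-- `G` is `k`-equistable: it has an equistable structure with weights in `{1,…,k}`. -/
def KEquistable [Fintype V] [DecidableEq V] (G : SimpleGraph V) (k : ℕ) : Prop :=
  ∃ t : ℕ, 0 < t ∧ ∃ w : V → ℕ, (∀ x, 1 ≤ w x ∧ w x ≤ k) ∧ EquistableStruct G w t

/-- `G` is target-`t` equistable: it has an equistable structure with positive
integer weights and target `t`. -/
def TargetEquistable [Fintype V] [DecidableEq V] (G : SimpleGraph V) (t : ℕ) : Prop :=
  ∃ w : V → ℕ, (∀ x, 1 ≤ w x) ∧ EquistableStruct G w t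

/-- Every stable set extends to a maximal stable set. -/
theorem exists_isMaxStable_superset [Fintype V] [DecidableEq V] (G : SimpleGraph V)
    (A : Finset V) (hA : IsStable G ↑A) : ∃ T : Finset V, A ⊆ T ∧ IsMaxStable G T := by
  obtain ⟨T, hAT, hT⟩ :=
    (Set.toFinite {T : Finset V | IsStable G ↑T}).exists_le_maximal hA
  exact ⟨T, hAT, hT.prop, fun U hU hTU => hT.eq_of_le hU hTU⟩

theorem stmt14 [Fintype V] [DecidableEq V] (G : SimpleGraph V) (k : ℕ)
    (X Y : Set V) (hX : TwinClass G X) (hY : TwinClass G Y) (hXY : X ≠ Y)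
    (hXs : IsStable G X) (hsee : ∀ x ∈ X, ∀ y ∈ Y, G.Adj x y)
    (S : Finset V) (hS : IsMaxStable G S) (hSY : ∃ y ∈ Y, y ∈ S)
    (hcard : k * S.card < X.ncard) :
    ¬ KEquistable G k := by
  rintro ⟨t, -, w, hw, hst⟩
  have ht : ∑ x ∈ S, w x = t := (hst S).mp hS
  have hup : t ≤ S.card * k := by
    rw [← ht]
    exact Finset.sum_le_card_nsmul S w k fun x _ => (hw x).2
  obtain ⟨T, hXT, hT⟩ := exists_isMaxStable_superset G X.toFinite.toFinset (by simpa using hXs)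
  have hlow : T.card ≤ t := by
    rw [← (hst T).mp hT]
    simpa using Finset.card_nsmul_le_sum T w 1 fun x _ => (hw x).1
  have hle := Finset.card_le_card hXT
  rw [← Set.ncard_eq_toFinset_card X] at hle
  rw [mul_comm] at hcard
  omega
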